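/- arXiv:1404.4860 — 3 statements merged into one kernel-verified Lean document; each statement's English description precedes it below -/
import Mathlib

section
/- Let φ be a flow on a generalized Peano continuum M. For each connected component X of HS (with the Hausdorff metric), let A_X = {x ∈ M : ω(x) ≠ ∅ and ω(x) ∈ X}. Then: (1) ⋃_{Λ ∈ X} Λ ⊆ A_X; (2) A_X is a connected, open, invariant subset of M; (3) for distinct components X ≠ X′ of HS, A_X ∩ A_{X′} = ∅; (4) for every x ∈ A_X with x ∉ ω(x), α(x) is contained in the topological boundary of A_X (possibly α(x) = ∅). -/
open Set Filter Topology Metric TopologicalSpace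

variable {M : Type*} [MetricSpace M]

/-- A set is invariant under the flow `φ`. -/
def IsFlowInvariant (φ : ℝ → M → M) (K : Set M) : Prop :=
  ∀ x ∈ K, ∀ t : ℝ, φ t x ∈ K

/-- A set is positively invariant under the flow `φ`. -/
def IsPosInvariant (φ : ℝ → M → M) (K : Set M) : Prop :=
  ∀ x ∈ K, ∀ t : ℝ, 0 ≤ t → φ t x ∈ K

/-- A compact minimal set: nonempty, compact, invariant, with no nonempty proper
closed invariant subset. -/
def IsCompactMinimalSet (φ : ℝ → M → M) (K : Set M) : Prop :=
  K.Nonempty ∧ IsCompact K ∧ IsFlowInvariant φ K ∧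
    ∀ K' ⊆ K, K'.Nonempty → IsClosed K' → IsFlowInvariant φ K' → K' = K

/-- Lyapunov stability: every neighborhood of `K` contains a positively invariant
neighborhood of `K`. -/
def IsLyapunovStable (φ : ℝ → M → M) (K : Set M) : Prop :=
  ∀ U ∈ 𝓝ˢ K, ∃ V ∈ 𝓝ˢ K, V ⊆ U ∧ IsPosInvariant φ V

/-- The ω-limit set of a point. -/
def omegaLimitSet (φ : ℝ → M → M) (x : M) : Set M :=
  ⋂ T ∈ Ici (0 : ℝ), closure ((fun t => φ t x) '' Ici T)

/-- The α-limit set of a point. -/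
def alphaLimitSet (φ : ℝ → M → M) (x : M) : Set M :=
  ⋂ T ∈ Iic (0 : ℝ), closure ((fun t => φ t x) '' Iic T)

/-- A compact minimal set is hyper-stable if some neighborhood of it in `M` meets no
Lyapunov unstable compact minimal set. -/
def IsHyperStable (φ : ℝ → M → M) (Λ : Set M) : Prop :=
  IsCompactMinimalSet φ Λ ∧ ∃ W ∈ 𝓝ˢ Λ, ∀ Γ : Set M,
    IsCompactMinimalSet φ Γ → ¬ IsLyapunovStable φ Γ → Γ ∩ W = ∅

/-- An attractor: a Lyapunov stable nonempty compact invariant set whose basin of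
attraction is a neighborhood of it. -/
def IsAttractorSet (φ : ℝ → M → M) (Δ : Set M) : Prop :=
  Δ.Nonempty ∧ IsCompact Δ ∧ IsFlowInvariant φ Δ ∧ IsLyapunovStable φ Δ ∧
    {x : M | (omegaLimitSet φ x).Nonempty ∧ omegaLimitSet φ x ⊆ Δ} ∈ 𝓝ˢ Δ

/-- The flow is non-wandering. -/
def IsNonWanderingFlow (φ : ℝ → M → M) : Prop :=
  ∀ x : M, ∀ U ∈ 𝓝 x, ∀ T > (0 : ℝ), ∃ t ≥ T, ((fun y => φ t y) '' U ∩ U).Nonempty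

/-- The set of hyper-stable compact minimal sets, as a subset of the space of nonempty
compact subsets of `M` (with the Hausdorff metric). -/
def HSset (φ : ℝ → M → M) : Set (NonemptyCompacts M) :=
  {Γ | IsHyperStable φ (Γ : Set M)}

/-- The set of all compact minimal sets, as a subset of the space of nonempty compact
subsets of `M` (with the Hausdorff metric). -/
def CMinSet (φ : ℝ → M → M) : Set (NonemptyCompacts M) :=
  {Γ | IsCompactMinimalSet φ (Γ : Set M)}

/-- `basinOf φ X` is the set of points whose ω-limit set belongs to `X`. -/
def basinOf (φ : ℝ → M → M) (X : Set (NonemptyCompacts M)) : Set M :=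
  {x | ∃ Γ ∈ X, (Γ : Set M) = omegaLimitSet φ x}

/-- The union in `M` of a family of hyper-stable compact minimal sets. -/
def unionSet (φ : ℝ → M → M) (X : Set ↥(HSset φ)) : Set M :=
  {y | ∃ q ∈ X, y ∈ ((q : NonemptyCompacts M) : Set M)}

theorem subset_of_forall_mem_nhdsSet {S Γ : Set M}
    (h : ∀ U ∈ 𝓝ˢ Γ, S ⊆ U) : S ⊆ Γ := by
  intro y hyS
  by_contra hy
  exact h {y}ᶜ (isOpen_compl_singleton.mem_nhdsSet.2 fun z hz hzy => hy (hzy ▸ hz)) hyS rfl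

section Limits

variable {φ : ℝ → M → M} {x y : M}

theorem mem_omegaLimitSet_iff :
    y ∈ omegaLimitSet φ x ↔ MapClusterPt y atTop (fun t => φ t x) := by
  rw [mapClusterPt_atTop_iff_forall_mem_closure]
  simp only [omegaLimitSet, mem_iInter]
  exact ⟨fun h T => closure_mono (image_mono (Ici_subset_Ici.2 (le_max_left T 0)))
    (h (max T 0) (le_max_right T 0)), fun h T _ => h T⟩

theorem mem_alphaLimitSet_iff :
    y ∈ alphaLimitSet φ x ↔ MapClusterPt y atBot (fun t => φ t x) := by
  have key : MapClusterPt y atBot (fun t => φ t x) ↔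
      ∀ T, y ∈ closure ((fun t => φ t x) '' Iic T) := by
    simp [MapClusterPt, (atBot_basis.map _).clusterPt_iff_forall_mem_closure]
  rw [key]
  simp only [alphaLimitSet, mem_iInter]
  exact ⟨fun h T => closure_mono (image_mono (Iic_subset_Iic.2 (min_le_left T 0)))
    (h (min T 0) (min_le_right T 0)), fun h T _ => h T⟩

theorem isClosed_omegaLimitSet : IsClosed (omegaLimitSet φ x) :=
  isClosed_biInter fun _ _ => isClosed_closure

theorem isClosed_alphaLimitSet : IsClosed (alphaLimitSet φ x) :=
  isClosed_biInter fun _ _ => isClosed_closure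

theorem omegaLimitSet_subset_of_eventually {F : Set M} (hF : IsClosed F)
    (h : ∀ᶠ t in atTop, φ t x ∈ F) : omegaLimitSet φ x ⊆ F :=
  fun _ hy => hF.mem_of_mapClusterPt (mem_omegaLimitSet_iff.1 hy) h

theorem omegaLimitSet_nonempty_of_eventually {K : Set M} (hK : IsCompact K)
    (h : ∀ᶠ t in atTop, φ t x ∈ K) : (omegaLimitSet φ x).Nonempty :=
  let ⟨y, _, hy⟩ := hK.exists_mapClusterPt_of_frequently h.frequently
  ⟨y, mem_omegaLimitSet_iff.2 hy⟩

end Limits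

namespace Flow

variable (φ : Flow ℝ M)

theorem neg_map_map (t : ℝ) (x : M) : φ (-t) (φ t x) = x := by
  rw [← φ.map_add, neg_add_cancel, φ.map_zero_apply]

theorem isFlowInvariant_omegaLimitSet (x : M) : IsFlowInvariant φ (omegaLimitSet φ x) := by
  intro y hy s
  rw [mem_omegaLimitSet_iff] at hy ⊢
  refine MapClusterPt.of_comp (tendsto_atTop_add_const_left atTop s tendsto_id) ?_
  have := hy.continuousAt_comp (φ.continuous_toFun s).continuousAt
  convert this using 1
  ext t
  exact φ.map_add s t x

theorem isFlowInvariant_alphaLimitSet (x : M) : IsFlowInvariant φ (alphaLimitSet φ x) := by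
  intro y hy s
  rw [mem_alphaLimitSet_iff] at hy ⊢
  refine MapClusterPt.of_comp (tendsto_atBot_add_const_left atBot s tendsto_id) ?_
  have := hy.continuousAt_comp (φ.continuous_toFun s).continuousAt
  convert this using 1
  ext t
  exact φ.map_add s t x

theorem omegaLimitSet_map_subset (s : ℝ) (x : M) :
    omegaLimitSet φ (φ s x) ⊆ omegaLimitSet φ x := by
  intro y hy
  rw [mem_omegaLimitSet_iff] at hy ⊢
  refine MapClusterPt.of_comp (tendsto_atTop_add_const_right atTop s tendsto_id) ?_
  convert hy using 1
  ext t
  exact φ.map_add t s x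

theorem omegaLimitSet_map (s : ℝ) (x : M) : omegaLimitSet φ (φ s x) = omegaLimitSet φ x := by
  refine (φ.omegaLimitSet_map_subset s x).antisymm ?_
  conv_lhs => rw [← φ.neg_map_map s x]
  exact φ.omegaLimitSet_map_subset (-s) (φ s x)

theorem isPreconnected_orbit_union_omegaLimitSet (x : M) :
    IsPreconnected (range (fun t => φ t x) ∪ omegaLimitSet φ x) := by
  have hc : Continuous fun t => φ t x := φ.continuous continuous_id continuous_const
  refine (isPreconnected_range hc).subset_closure subset_union_left
    (union_subset subset_closure fun y hy => ?_)
  exact isClosed_closure.mem_of_mapClusterPt (mem_omegaLimitSet_iff.1 hy)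
    (Eventually.of_forall fun t => subset_closure (mem_range_self t))

variable {φ}

theorem exists_isCompactMinimalSet_subset {K : Set M} (hne : K.Nonempty) (hK : IsCompact K)
    (hinv : IsFlowInvariant φ K) : ∃ Γ ⊆ K, IsCompactMinimalSet φ Γ := by
  obtain ⟨Γ, hΓK, hΓ⟩ := zorn_superset_nonempty
    {L : Set M | L ⊆ K ∧ L.Nonempty ∧ IsClosed L ∧ IsFlowInvariant φ L} (fun c hc hchain hcne => by
      have : Nonempty c := hcne.to_subtype
      obtain ⟨L₀, hL₀⟩ := hcne
      refine ⟨⋂₀ c, ⟨(sInter_subset_of_mem hL₀).trans (hc hL₀).1, ?_,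
        isClosed_sInter fun L hL => (hc hL).2.2.1,
        fun x hx t L hL => (hc hL).2.2.2 x (hx L hL) t⟩, fun L hL => sInter_subset_of_mem hL⟩
      refine IsCompact.nonempty_sInter_of_directed_nonempty_isCompact_isClosed ?_
        (fun L hL => (hc hL).2.1) (fun L hL => hK.of_isClosed_subset (hc hL).2.2.1 (hc hL).1)
        (fun L hL => (hc hL).2.2.1)
      have hchain' : IsChain (· ⊇ ·) c := hchain.symm
      exact hchain'.directedOn) K ⟨subset_rfl, hne, hK.isClosed, hinv⟩
  obtain ⟨_, hΓne, hΓcl, hΓinv⟩ := hΓ.prop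
  exact ⟨Γ, hΓK, hΓne, hK.of_isClosed_subset hΓcl hΓK, hΓinv, fun L hLΓ hLne hLcl hLinv =>
    hLΓ.antisymm (hΓ.le_of_le ⟨hLΓ.trans hΓK, hLne, hLcl, hLinv⟩ hLΓ)⟩

theorem eventually_mem_of_isPosInvariant {V : Set M} {x : M} {s : ℝ}
    (hV : IsPosInvariant φ V) (hs : φ s x ∈ V) : ∀ᶠ t in atTop, φ t x ∈ V := by
  filter_upwards [eventually_ge_atTop s] with t ht
  have := hV _ hs (t - s) (sub_nonneg.2 ht)
  rwa [← φ.map_add, sub_add_cancel] at this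

theorem exists_map_mem_of_mem_omegaLimitSet {V : Set M} {x y : M} (hy : y ∈ omegaLimitSet φ x)
    (hV : V ∈ 𝓝 y) : ∃ s, φ s x ∈ V :=
  ((mem_omegaLimitSet_iff.1 hy).frequently hV).exists

theorem omegaLimitSet_eq_of_mem {Γ : Set M} {x : M} (hΓ : IsCompactMinimalSet φ Γ) (hx : x ∈ Γ) :
    omegaLimitSet φ x = Γ :=
  have h : ∀ᶠ t in atTop, φ t x ∈ Γ := Eventually.of_forall fun t => hΓ.2.2.1 x hx t
  hΓ.2.2.2 _ (omegaLimitSet_subset_of_eventually hΓ.2.1.isClosed h)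
    (omegaLimitSet_nonempty_of_eventually hΓ.2.1 h) isClosed_omegaLimitSet
    (φ.isFlowInvariant_omegaLimitSet x)

theorem omegaLimitSet_eq_of_isLyapunovStable {Γ : Set M} {x : M} (hΓ : IsCompactMinimalSet φ Γ)
    (hst : IsLyapunovStable φ Γ) (hsub : Γ ⊆ omegaLimitSet φ x) : omegaLimitSet φ x = Γ := by
  refine Subset.antisymm (subset_of_forall_mem_nhdsSet fun U hU => ?_) hsub
  obtain ⟨C, ⟨hC, hCcl⟩, hCU⟩ := (closed_nhdsSet_basis Γ hΓ.2.1.isClosed).mem_iff.1 hU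
  obtain ⟨V, hV, hVC, hVinv⟩ := hst C hC
  obtain ⟨y, hy⟩ := hΓ.1
  obtain ⟨s, hs⟩ := exists_map_mem_of_mem_omegaLimitSet (hsub hy) (mem_nhdsSet_iff_forall.1 hV y hy)
  exact (omegaLimitSet_subset_of_eventually hCcl
    ((eventually_mem_of_isPosInvariant hVinv hs).mono fun t ht => hVC ht)).trans hCU

theorem _root_.IsHyperStable.isLyapunovStable {Γ : Set M} (h : IsHyperStable φ Γ) :
    IsLyapunovStable φ Γ := by
  obtain ⟨hΓ, W, hW, hWΓ⟩ := h
  by_contra hst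
  obtain ⟨y, hy⟩ := hΓ.1
  exact (hWΓ Γ hΓ hst).subset ⟨hy, subset_of_mem_nhdsSet hW hy⟩

theorem _root_.IsHyperStable.exists_nhdsSet [LocallyCompactSpace M] {Γ U : Set M}
    (h : IsHyperStable φ Γ) (hU : U ∈ 𝓝ˢ Γ) :
    ∃ V ∈ 𝓝ˢ Γ, ∀ x ∈ V, IsHyperStable φ (omegaLimitSet φ x) ∧ omegaLimitSet φ x ⊆ U := by
  have hst := h.isLyapunovStable
  obtain ⟨hΓ, W, hW, hWΓ⟩ := h
  obtain ⟨K, ⟨hK, hKcpt⟩, hKW⟩ := hΓ.2.1.nhdsSet_basis_isCompact.mem_iff.1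
    (inter_mem hU (isOpen_interior.mem_nhdsSet.2 (subset_interior_iff_mem_nhdsSet.2 hW)))
  obtain ⟨V, hV, hVK, hVinv⟩ := hst K hK
  refine ⟨V, hV, fun x hx => ?_⟩
  have hev : ∀ᶠ t in atTop, φ t x ∈ K := by
    filter_upwards [eventually_ge_atTop 0] with t ht using hVK (hVinv x hx t ht)
  have hsub : omegaLimitSet φ x ⊆ K := omegaLimitSet_subset_of_eventually hKcpt.isClosed hev
  obtain ⟨Δ, hΔsub, hΔ⟩ := exists_isCompactMinimalSet_subset
    (omegaLimitSet_nonempty_of_eventually hKcpt hev)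
    (hKcpt.of_isClosed_subset isClosed_omegaLimitSet hsub) (φ.isFlowInvariant_omegaLimitSet x)
  have hΔW : Δ ⊆ interior W := fun y hy => (hKW (hsub (hΔsub hy))).2
  have hΔst : IsLyapunovStable φ Δ := by
    by_contra hns
    obtain ⟨y, hy⟩ := hΔ.1
    exact (hWΓ Δ hΔ hns).subset ⟨hy, interior_subset (hΔW hy)⟩
  refine ⟨?_, fun y hy => (hKW (hsub hy)).1⟩
  rw [omegaLimitSet_eq_of_isLyapunovStable hΔ hΔst hΔsub]
  exact ⟨hΔ, W, mem_of_superset (isOpen_interior.mem_nhdsSet.2 hΔW) interior_subset, hWΓ⟩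

theorem mem_basinOf_HSset_iff {x : M} :
    x ∈ basinOf φ (HSset φ) ↔ IsHyperStable φ (omegaLimitSet φ x) := by
  refine ⟨fun ⟨Γ, hΓ, h⟩ => h ▸ hΓ, fun h => ?_⟩
  exact ⟨⟨⟨omegaLimitSet φ x, h.1.2.1⟩, h.1.1⟩, h, rfl⟩

theorem eventually_isHyperStable_omegaLimitSet [LocallyCompactSpace M] {x : M} {U : Set M}
    (hx : IsHyperStable φ (omegaLimitSet φ x)) (hU : U ∈ 𝓝ˢ (omegaLimitSet φ x)) :
    ∀ᶠ y in 𝓝 x, IsHyperStable φ (omegaLimitSet φ y) ∧ omegaLimitSet φ y ⊆ U := by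
  obtain ⟨V, hV, hVU⟩ := hx.exists_nhdsSet hU
  obtain ⟨z, hz⟩ := hx.1.1
  obtain ⟨s, hs⟩ := exists_map_mem_of_mem_omegaLimitSet hz
    (interior_mem_nhds.2 (mem_nhdsSet_iff_forall.1 hV z hz))
  filter_upwards [(φ.continuous_toFun s).continuousAt.preimage_mem_nhds
    (isOpen_interior.mem_nhds hs)] with y hy
  simpa only [φ.omegaLimitSet_map] using hVU _ (interior_subset hy)

/-- Lower semicontinuity of the `ω`-limit set at points whose `ω`-limit set is hyper-stable. -/
theorem eventually_omegaLimitSet_inter_nonempty [LocallyCompactSpace M] {x : M} {U : Set M}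
    (hx : IsHyperStable φ (omegaLimitSet φ x)) (hU : IsOpen U)
    (hxU : (omegaLimitSet φ x ∩ U).Nonempty) :
    ∀ᶠ y in 𝓝 x, (omegaLimitSet φ y ∩ U).Nonempty := by
  obtain ⟨p, hp, hpU⟩ := hxU
  have hopen : IsOpen (⋃ t, φ t ⁻¹' U) :=
    isOpen_iUnion fun t => hU.preimage (φ.continuous_toFun t)
  have hsub : omegaLimitSet φ x ⊆ ⋃ t, φ t ⁻¹' U := fun z hz => by
    rw [← omegaLimitSet_eq_of_mem hx.1 hz] at hp
    exact mem_iUnion.2 (exists_map_mem_of_mem_omegaLimitSet hp (hU.mem_nhds hpU))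
  filter_upwards [eventually_isHyperStable_omegaLimitSet hx (hopen.mem_nhdsSet.2 hsub)] with y hy
  obtain ⟨z, hz⟩ := hy.1.1.1
  obtain ⟨t, ht⟩ := mem_iUnion.1 (hy.2 hz)
  exact ⟨φ t z, φ.isFlowInvariant_omegaLimitSet y z hz t, ht⟩

variable (φ) in
/-- The `ω`-limit set of a point of the basin of `HS`, as an element of the hyperspace. -/
noncomputable def omegaCompacts (x : basinOf φ (HSset φ)) : NonemptyCompacts M :=
  x.2.choose

theorem omegaCompacts_mem (x : basinOf φ (HSset φ)) : φ.omegaCompacts x ∈ HSset φ :=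
  x.2.choose_spec.1

theorem coe_omegaCompacts (x : basinOf φ (HSset φ)) :
    (φ.omegaCompacts x : Set M) = omegaLimitSet φ x :=
  x.2.choose_spec.2

theorem continuous_omegaCompacts [LocallyCompactSpace M] : Continuous φ.omegaCompacts := by
  refine continuous_induced_rng.2 (continuous_generateFrom_iff.2 ?_)
  rintro _ (⟨U, hU, rfl⟩ | ⟨U, hU, rfl⟩) <;>
    refine isOpen_iff_mem_nhds.2 fun x hx => ?_ <;>
    simp only [mem_preimage, Function.comp_apply, mem_powerset_iff, mem_ofPred_eq,
      coe_omegaCompacts] at hx <;>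
    rw [nhds_subtype]
  · filter_upwards [(eventually_isHyperStable_omegaLimitSet (mem_basinOf_HSset_iff.1 x.2)
      (hU.mem_nhdsSet.2 hx)).comap Subtype.val] with y hy
    simpa only [mem_preimage, Function.comp_apply, mem_powerset_iff, coe_omegaCompacts] using hy.2
  · filter_upwards [(eventually_omegaLimitSet_inter_nonempty (mem_basinOf_HSset_iff.1 x.2)
      hU hx).comap Subtype.val] with y hy
    simpa only [mem_preimage, Function.comp_apply, mem_ofPred_eq, coe_omegaCompacts] using hy

theorem isOpen_basinOf_connectedComponentIn [LocallyCompactSpace M] [LocallyConnectedSpace M]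
    (Λ : NonemptyCompacts M) : IsOpen (basinOf φ (connectedComponentIn (HSset φ) Λ)) := by
  refine isOpen_iff_mem_nhds.2 fun x ⟨Γ, hΓ, hΓx⟩ => ?_
  have hΓHS := connectedComponentIn_subset _ _ hΓ
  have hx : IsHyperStable φ (omegaLimitSet φ x) := hΓx ▸ hΓHS
  have hA : basinOf φ (HSset φ) ∈ 𝓝 x := by
    filter_upwards [eventually_isHyperStable_omegaLimitSet hx univ_mem] with y hy
    exact mem_basinOf_HSset_iff.2 hy.1
  have hxA : x ∈ basinOf φ (HSset φ) := mem_of_mem_nhds hA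
  set C := connectedComponentIn (basinOf φ (HSset φ)) x
  have hCA : C ⊆ basinOf φ (HSset φ) := connectedComponentIn_subset _ _
  have hpre : IsPreconnected (φ.omegaCompacts '' (Subtype.val ⁻¹' C)) := by
    refine IsPreconnected.image ?_ _ continuous_omegaCompacts.continuousOn
    rw [← IsInducing.subtypeVal.isPreconnected_image, image_preimage_eq_of_subset (by simpa)]
    exact isPreconnected_connectedComponentIn
  have hsub := hpre.subset_connectedComponentIn
    (mem_image_of_mem _ (show (⟨x, hxA⟩ : basinOf φ (HSset φ)) ∈ Subtype.val ⁻¹' C from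
      mem_connectedComponentIn hxA)) (F := HSset φ)
    (by rintro _ ⟨y, -, rfl⟩; exact omegaCompacts_mem y)
  have hΓeq : φ.omegaCompacts ⟨x, hxA⟩ = Γ :=
    SetLike.coe_injective ((coe_omegaCompacts _).trans hΓx.symm)
  rw [hΓeq, ← connectedComponentIn_eq hΓ] at hsub
  filter_upwards [connectedComponentIn_mem_nhds hA] with y hy
  exact ⟨φ.omegaCompacts ⟨y, hCA hy⟩, hsub ⟨⟨y, hCA hy⟩, hy, rfl⟩, coe_omegaCompacts _⟩

theorem isFlowInvariant_basinOf (X : Set (NonemptyCompacts M)) :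
    IsFlowInvariant φ (basinOf φ X) :=
  fun x ⟨Γ, hΓ, hx⟩ t => ⟨Γ, hΓ, hx.trans (φ.omegaLimitSet_map t x).symm⟩

theorem subset_basinOf {X : Set (NonemptyCompacts M)} (hX : X ⊆ CMinSet φ)
    {Γ : NonemptyCompacts M} (hΓ : Γ ∈ X) : (Γ : Set M) ⊆ basinOf φ X :=
  fun _ hx => ⟨Γ, hΓ, (omegaLimitSet_eq_of_mem (hX hΓ) hx).symm⟩

theorem isPreconnected_basinOf {X : Set (NonemptyCompacts M)} (hX : X ⊆ CMinSet φ)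
    (hconn : IsPreconnected X) : IsPreconnected (basinOf φ X) := by
  have hpiece : ∀ x ∈ basinOf φ X, range (fun t => φ t x) ∪ omegaLimitSet φ x ⊆ basinOf φ X := by
    intro x hx
    refine union_subset (range_subset_iff.2 fun t => isFlowInvariant_basinOf X x hx t) ?_
    obtain ⟨Γ, hΓ, h⟩ := hx
    exact h ▸ subset_basinOf hX hΓ
  intro u v hu hv huv ⟨x, hx, hxu⟩ ⟨y, hy, hyv⟩
  by_contra hempty
  have hmeet : ∀ {a b : Set M}, IsOpen a → IsOpen b → basinOf φ X ⊆ a ∪ b →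
      ¬ (basinOf φ X ∩ (a ∩ b)).Nonempty → ∀ z ∈ basinOf φ X, z ∈ a →
        ∃ Γ ∈ X, ((Γ : Set M) ∩ a).Nonempty := by
    intro a b ha hb hab hne z hz hza
    obtain ⟨Γ, hΓ, h⟩ := id hz
    obtain ⟨w, hw⟩ := Γ.nonempty
    have hzp : z ∈ range (fun t => φ t z) ∪ omegaLimitSet φ z :=
      Or.inl ⟨0, φ.map_zero_apply z⟩
    have hwp : w ∈ range (fun t => φ t z) ∪ omegaLimitSet φ z := Or.inr (h ▸ hw)
    refine ⟨Γ, hΓ, w, hw, by_contra fun hwa => hne ?_⟩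
    exact ((φ.isPreconnected_orbit_union_omegaLimitSet z) a b ha hb ((hpiece z hz).trans hab)
      ⟨z, hzp, hza⟩ ⟨w, hwp, (hab (hpiece z hz hwp)).resolve_left hwa⟩).mono
      (inter_subset_inter_left _ (hpiece z hz))
  obtain ⟨Γ₁, h₁, h₁u⟩ := hmeet hu hv huv hempty x hx hxu
  obtain ⟨Γ₂, h₂, h₂v⟩ := hmeet hv hu (union_comm u v ▸ huv) (inter_comm u v ▸ hempty) y hy hyv
  obtain ⟨Γ, hΓ, ⟨p, hp, hpu⟩, q, hq, hqv⟩ := hconn _ _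
    (NonemptyCompacts.isOpen_inter_nonempty_of_isOpen hu)
    (NonemptyCompacts.isOpen_inter_nonempty_of_isOpen hv)
    (fun Γ hΓ => by
      obtain ⟨w, hw⟩ := Γ.nonempty
      exact (huv (subset_basinOf hX hΓ hw)).imp (fun h => ⟨w, hw, h⟩) fun h => ⟨w, hw, h⟩)
    ⟨Γ₁, h₁, h₁u⟩ ⟨Γ₂, h₂, h₂v⟩
  have hΓsub := subset_basinOf hX hΓ
  have hΓpre : IsPreconnected (Γ : Set M) := by
    have := φ.isPreconnected_orbit_union_omegaLimitSet p
    rwa [omegaLimitSet_eq_of_mem (hX hΓ) hp, union_eq_self_of_subset_left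
      (range_subset_iff.2 fun t => (hX hΓ).2.2.1 p hp t)] at this
  exact hempty ((hΓpre u v hu hv (hΓsub.trans huv) ⟨p, hp, hpu⟩ ⟨q, hq, hqv⟩).mono
    (inter_subset_inter_left _ hΓsub))

theorem mem_of_isLyapunovStable_of_subset_alphaLimitSet {Γ : Set M} {x : M} (hne : Γ.Nonempty)
    (hst : IsLyapunovStable φ Γ) (hsub : Γ ⊆ alphaLimitSet φ x) : x ∈ Γ := by
  refine singleton_subset_iff.1 (subset_of_forall_mem_nhdsSet fun U hU => ?_)
  obtain ⟨V, hV, hVU, hVinv⟩ := hst U hU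
  obtain ⟨y, hy⟩ := hne
  obtain ⟨t, ht, ht0⟩ := (((mem_alphaLimitSet_iff.1 (hsub hy)).frequently
    (mem_nhdsSet_iff_forall.1 hV y hy)).and_eventually (eventually_le_atBot 0)).exists
  have := hVinv _ ht (-t) (neg_nonneg.2 ht0)
  rw [φ.neg_map_map] at this
  exact singleton_subset_iff.2 (hVU this)

theorem alphaLimitSet_subset_frontier_basinOf {X : Set (NonemptyCompacts M)} (hX : X ⊆ HSset φ)
    (hopen : IsOpen (basinOf φ X)) {x : M} (hx : x ∈ basinOf φ X) (hxω : x ∉ omegaLimitSet φ x) :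
    alphaLimitSet φ x ⊆ frontier (basinOf φ X) := by
  intro z hz
  rw [hopen.frontier_eq]
  refine ⟨isClosed_closure.mem_of_mapClusterPt (mem_alphaLimitSet_iff.1 hz)
    (Eventually.of_forall fun t => subset_closure (isFlowInvariant_basinOf X x hx t)), ?_⟩
  rintro ⟨Γ, hΓ, hΓz⟩
  have hΓHS : IsHyperStable φ (Γ : Set M) := hX hΓ
  have hsub : (Γ : Set M) ⊆ alphaLimitSet φ x := hΓz ▸
    omegaLimitSet_subset_of_eventually isClosed_alphaLimitSet
      (Eventually.of_forall fun t => φ.isFlowInvariant_alphaLimitSet x z hz t)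
  have hxΓ := mem_of_isLyapunovStable_of_subset_alphaLimitSet hΓHS.1.1
    hΓHS.isLyapunovStable hsub
  exact hxω (omegaLimitSet_eq_of_mem hΓHS.1 hxΓ ▸ hxΓ)

end Flow

theorem basin_of_component_of_HS [LocallyCompactSpace M] [ConnectedSpace M] [LocallyConnectedSpace M]
    (φ : ℝ → M → M)
    (hφcont : Continuous fun p : ℝ × M => φ p.1 p.2)
    (hφzero : ∀ x : M, φ 0 x = x)
    (hφadd : ∀ s t : ℝ, ∀ x : M, φ s (φ t x) = φ (s + t) x)
    (Λ₀ : NonemptyCompacts M) (hΛ₀ : Λ₀ ∈ HSset φ) :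
    (∀ Γ ∈ connectedComponentIn (HSset φ) Λ₀,
        (Γ : Set M) ⊆ basinOf φ (connectedComponentIn (HSset φ) Λ₀)) ∧
      IsConnected (basinOf φ (connectedComponentIn (HSset φ) Λ₀)) ∧
      IsOpen (basinOf φ (connectedComponentIn (HSset φ) Λ₀)) ∧
      IsFlowInvariant φ (basinOf φ (connectedComponentIn (HSset φ) Λ₀)) ∧
      (∀ Λ₁ ∈ HSset φ, connectedComponentIn (HSset φ) Λ₁ ≠ connectedComponentIn (HSset φ) Λ₀ →
        basinOf φ (connectedComponentIn (HSset φ) Λ₁) ∩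
          basinOf φ (connectedComponentIn (HSset φ) Λ₀) = ∅) ∧
      ∀ x ∈ basinOf φ (connectedComponentIn (HSset φ) Λ₀), x ∉ omegaLimitSet φ x →
        alphaLimitSet φ x ⊆ frontier (basinOf φ (connectedComponentIn (HSset φ) Λ₀)) := by
  let F : Flow ℝ M :=
    { toFun := φ, cont' := hφcont, map_add' := fun s t x => (hφadd s t x).symm,
      map_zero' := hφzero }
  have hHS : connectedComponentIn (HSset φ) Λ₀ ⊆ HSset φ := connectedComponentIn_subset _ _
  have hmin : connectedComponentIn (HSset φ) Λ₀ ⊆ CMinSet φ := fun Γ hΓ => (hHS hΓ).1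
  have hopen := Flow.isOpen_basinOf_connectedComponentIn (φ := F) Λ₀
  have hsub := fun Γ hΓ => Flow.subset_basinOf (φ := F) hmin (Γ := Γ) hΓ
  refine ⟨hsub, ⟨Λ₀.nonempty.mono (hsub Λ₀ (mem_connectedComponentIn hΛ₀)),
    Flow.isPreconnected_basinOf (φ := F) hmin isPreconnected_connectedComponentIn⟩, hopen,
    Flow.isFlowInvariant_basinOf (φ := F) _, fun Λ₁ _ hne => ?_, fun x hx hxω =>
    Flow.alphaLimitSet_subset_frontier_basinOf (φ := F) hHS hopen hx hxω⟩
  refine eq_empty_of_forall_notMem fun x ⟨⟨Γ, hΓ, hΓx⟩, Γ', hΓ', hΓx'⟩ => hne ?_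
  obtain rfl : Γ = Γ' := SetLike.coe_injective (hΓx.trans hΓx'.symm)
  rw [connectedComponentIn_eq hΓ, connectedComponentIn_eq hΓ']
end

section
/- Let φ be a non-wandering flow on a generalized Peano continuum M. Then exactly one of the following holds: (1) HS = ∅, i.e., every compact minimal set lies in the Hausdorff-metric closure of the set of Lyapunov unstable compact minimal sets; (2) M is compact and the flow is minimal (every orbit is dense in M) and HS = {M}; (3) HS, with the Hausdorff metric, has at least one and at most countably many connected components, each component X is open and closed in HS, is a generalized Peano continuum, contains more than one element, and the union ⋃_{Λ ∈ X} Λ is a nonempty, connected, open, invariant subset of M. -/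
open Set Filter Topology Metric TopologicalSpace

variable {M : Type*} [MetricSpace M]

/-- Alternative (1): `HS` is empty, i.e. the Lyapunov unstable compact minimal sets are
dense (w.r.t. the Hausdorff metric) in the set of all compact minimal sets. -/
def NWAlt1 (φ : ℝ → M → M) : Prop :=
  HSset φ = ∅ ∧ ∀ Γ ∈ CMinSet φ, Γ ∈ closure {Δ : NonemptyCompacts M |
    IsCompactMinimalSet φ (Δ : Set M) ∧ ¬ IsLyapunovStable φ (Δ : Set M)}

/-- Alternative (2): `M` is compact, the flow is minimal, and `HS = {M}`. -/
def NWAlt2 (φ : ℝ → M → M) : Prop :=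
  CompactSpace M ∧ (∀ x : M, Dense (Set.range fun t : ℝ => φ t x)) ∧
    HSset φ = {Γ : NonemptyCompacts M | (Γ : Set M) = Set.univ}

/-- Alternative (3): `HS` is nonempty, has at most countably many connected components,
and each component is clopen, is a generalized Peano continuum, has more than one
element, and its union in `M` is a nonempty, connected, open, invariant set. -/
def NWAlt3 (φ : ℝ → M → M) : Prop :=
  (HSset φ).Nonempty ∧
  {S : Set ↥(HSset φ) | ∃ p : ↥(HSset φ), S = connectedComponent p}.Countable ∧
  ∀ p : ↥(HSset φ),
    IsClopen (connectedComponent p) ∧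
    LocallyCompactSpace ↥(connectedComponent p) ∧
    ConnectedSpace ↥(connectedComponent p) ∧
    LocallyConnectedSpace ↥(connectedComponent p) ∧
    (connectedComponent p).Nontrivial ∧
    (unionSet φ (connectedComponent p)).Nonempty ∧
    IsConnected (unionSet φ (connectedComponent p)) ∧
    IsOpen (unionSet φ (connectedComponent p)) ∧
    IsFlowInvariant φ (unionSet φ (connectedComponent p))

/-- A connected, locally compact metric space is separable. -/
theorem separableSpace_of_connectedSpace_of_locallyCompactSpace
    [LocallyCompactSpace M] [ConnectedSpace M] : SeparableSpace M := by
  obtain ⟨u, huo, hucov, hulf, husub⟩ :=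
    precise_refinement (fun x : M => interior (exists_compact_mem_nhds x).choose)
      (fun _ => isOpen_interior) (eq_univ_of_forall fun x => mem_iUnion.2
        ⟨x, mem_interior_iff_mem_nhds.2 (exists_compact_mem_nhds x).choose_spec.2⟩)
  have hucomp : ∀ i, IsCompact (closure (u i)) := fun i =>
    (exists_compact_mem_nhds i).choose_spec.1.closure_of_subset
      ((husub i).trans interior_subset)
  have hmem : ∀ x, ∃ i, x ∈ u i := fun x => mem_iUnion.1 (hucov ▸ mem_univ x)
  let star : Set M → Set M := fun K => ⋃ i ∈ {i | (u i ∩ K).Nonempty}, closure (u i)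
  have hstar : ∀ K, IsCompact K → IsCompact (star K) := fun K hK =>
    (hulf.finite_nonempty_inter_compact hK).isCompact_biUnion fun i _ => hucomp i
  have hsub : ∀ K i, (u i ∩ K).Nonempty → u i ⊆ star K := fun K i h =>
    subset_closure.trans (subset_biUnion_of_mem (u := fun i => closure (u i)) h)
  obtain ⟨x₀⟩ : Nonempty M := inferInstance
  let K : ℕ → Set M := fun n => star^[n] {x₀}
  have hKsucc : ∀ n, K (n + 1) = star (K n) := fun n => Function.iterate_succ_apply' _ _ _
  have hK : ∀ n, IsCompact (K n) := fun n => by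
    induction n with
    | zero => exact isCompact_singleton
    | succ n ih => rw [hKsucc]; exact hstar _ ih
  have hstep : ∀ i n, (u i ∩ K n).Nonempty → u i ⊆ ⋃ n, K n := fun i n h =>
    (hsub _ _ h).trans (hKsucc n ▸ subset_iUnion K (n + 1))
  have hclopen : IsClopen (⋃ n, K n) := by
    refine ⟨isClosed_of_closure_subset fun x hx => ?_, isOpen_iff_mem_nhds.2 fun x hx => ?_⟩
    · obtain ⟨i, hi⟩ := hmem x
      obtain ⟨y, hyu, hy⟩ := mem_closure_iff.1 hx _ (huo i) hi
      obtain ⟨n, hn⟩ := mem_iUnion.1 hy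
      exact hstep i n ⟨y, hyu, hn⟩ hi
    · obtain ⟨i, hi⟩ := hmem x
      obtain ⟨n, hn⟩ := mem_iUnion.1 hx
      exact mem_of_superset ((huo i).mem_nhds hi) (hstep i n ⟨x, hi, hn⟩)
  have huniv := hclopen.eq_univ ⟨x₀, mem_iUnion.2 ⟨0, rfl⟩⟩
  rw [← isSeparable_univ_iff, ← huniv]
  exact IsSeparable.iUnion fun n => (hK n).isSeparable

/-- The forward orbit of a point. -/
def forwardOrbit (φ : ℝ → M → M) (x : M) : Set M := (fun t => φ t x) '' Ici 0

section Invariance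

variable {X : Type*} {φ : ℝ → X → X}

theorem mem_forwardOrbit_self (hφzero : ∀ x : X, φ 0 x = x) (x : X) : x ∈ forwardOrbit φ x :=
  ⟨0, self_mem_Ici, hφzero x⟩

theorem isPosInvariant_forwardOrbit (hφadd : ∀ s t : ℝ, ∀ x : X, φ s (φ t x) = φ (s + t) x)
    (x : X) : IsPosInvariant φ (forwardOrbit φ x) := by
  rintro _ ⟨s, hs, rfl⟩ t ht
  exact ⟨t + s, add_nonneg ht hs, (hφadd t s x).symm⟩

theorem IsFlowInvariant.isPosInvariant {K : Set X} (h : IsFlowInvariant φ K) :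
    IsPosInvariant φ K := fun x hx t _ => h x hx t

theorem IsPosInvariant.forwardOrbit_subset {A : Set X} (hA : IsPosInvariant φ A) {x : X}
    (hx : x ∈ A) : forwardOrbit φ x ⊆ A := by
  rintro _ ⟨t, ht, rfl⟩
  exact hA x hx t ht

theorem IsPosInvariant.inter {A B : Set X} (hA : IsPosInvariant φ A)
    (hB : IsPosInvariant φ B) : IsPosInvariant φ (A ∩ B) := fun x hx t ht =>
  ⟨hA x hx.1 t ht, hB x hx.2 t ht⟩

end Invariance

section Flow

variable {φ : ℝ → M → M}

theorem IsPosInvariant.closure (hφ : ∀ t, Continuous (φ t)) {A : Set M}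
    (hA : IsPosInvariant φ A) : IsPosInvariant φ (closure A) := fun _ hx t ht =>
  map_mem_closure (hφ t) hx fun y hy => hA y hy t ht

/-- A nonempty compact positively invariant set contains a compact minimal set. -/
theorem IsPosInvariant.exists_isCompactMinimalSet (hφ : ∀ t, Continuous (φ t))
    (hφzero : ∀ x : M, φ 0 x = x)
    (hφadd : ∀ s t : ℝ, ∀ x : M, φ s (φ t x) = φ (s + t) x)
    {A : Set M} (hA : IsPosInvariant φ A) (hAc : IsCompact A) (hAne : A.Nonempty) :
    ∃ N ⊆ A, IsCompactMinimalSet φ N := by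
  obtain ⟨N, hN⟩ := zorn_superset
    {N : Set M | N ⊆ A ∧ N.Nonempty ∧ IsClosed N ∧ IsPosInvariant φ N} (by
      intro c hc hchain
      rcases c.eq_empty_or_nonempty with rfl | hcne
      · exact ⟨A, ⟨Subset.rfl, hAne, hAc.isClosed, hA⟩, by simp⟩
      · refine ⟨⋂₀ c, ⟨?_, ?_, ?_, ?_⟩, fun s hs => sInter_subset_of_mem hs⟩
        · obtain ⟨s, hs⟩ := hcne
          exact (sInter_subset_of_mem hs).trans (hc hs).1
        · have : Nonempty c := hcne.to_subtype
          exact IsCompact.nonempty_sInter_of_directed_nonempty_isCompact_isClosed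
            (fun a ha b hb => (hchain.total ha hb).elim
              (fun h => ⟨a, ha, Subset.rfl, h⟩) (fun h => ⟨b, hb, h, Subset.rfl⟩))
            (fun s hs => (hc hs).2.1)
            (fun s hs => hAc.of_isClosed_subset (hc hs).2.2.1 (hc hs).1)
            (fun s hs => (hc hs).2.2.1)
        · exact isClosed_sInter fun s hs => (hc hs).2.2.1
        · exact fun x hx t ht s hs => (hc hs).2.2.2 x (hx s hs) t ht)
  obtain ⟨hNA, hNne, hNcl, hNpos⟩ := hN.prop
  have hNc : IsCompact N := hAc.of_isClosed_subset hNcl hNA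
  have hmin : ∀ B ⊆ N, B.Nonempty → IsClosed B → IsPosInvariant φ B → B = N :=
    fun B hB hne hcl hpos =>
      hB.antisymm (hN.le_of_le ⟨hB.trans hNA, hne, hcl, hpos⟩ hB)
  have himage : ∀ t, 0 ≤ t → φ t '' N = N := by
    intro t ht
    refine hmin _ ?_ (hNne.image _) (hNc.image (hφ t)).isClosed ?_
    · rintro _ ⟨x, hx, rfl⟩
      exact hNpos x hx t ht
    · rintro _ ⟨x, hx, rfl⟩ s hs
      exact ⟨φ s x, hNpos x hx s hs, by rw [hφadd, hφadd, add_comm]⟩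
  refine ⟨N, hNA, hNne, hNc, fun x hx t => ?_, fun B hB hne hcl hinv =>
    hmin B hB hne hcl hinv.isPosInvariant⟩
  rcases le_total 0 t with ht | ht
  · exact hNpos x hx t ht
  · rw [← himage (-t) (neg_nonneg.2 ht)] at hx
    obtain ⟨y, hy, rfl⟩ := hx
    rwa [hφadd, add_neg_cancel, hφzero]

/-- A compact minimal set meeting a closed positively invariant set is contained in it. -/
theorem IsCompactMinimalSet.subset_of_inter_nonempty (hφ : ∀ t, Continuous (φ t))
    (hφzero : ∀ x : M, φ 0 x = x)
    (hφadd : ∀ s t : ℝ, ∀ x : M, φ s (φ t x) = φ (s + t) x)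
    {Γ A : Set M} (hΓ : IsCompactMinimalSet φ Γ) (hAcl : IsClosed A)
    (hA : IsPosInvariant φ A) (hne : (Γ ∩ A).Nonempty) : Γ ⊆ A := by
  obtain ⟨-, hΓc, hΓinv, hΓmin⟩ := hΓ
  obtain ⟨N, hNsub, hNne, hNc, hNinv, -⟩ :=
    (hΓinv.isPosInvariant.inter hA).exists_isCompactMinimalSet hφ hφzero hφadd
      (hΓc.inter_right hAcl) hne
  rw [← hΓmin N (hNsub.trans inter_subset_left) hNne hNc.isClosed hNinv]
  exact hNsub.trans inter_subset_right

theorem IsCompactMinimalSet.subset_closure_forwardOrbit (hφ : ∀ t, Continuous (φ t))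
    (hφzero : ∀ x : M, φ 0 x = x)
    (hφadd : ∀ s t : ℝ, ∀ x : M, φ s (φ t x) = φ (s + t) x)
    {Γ : Set M} (hΓ : IsCompactMinimalSet φ Γ) {x : M} (hx : x ∈ Γ) :
    Γ ⊆ closure (forwardOrbit φ x) :=
  hΓ.subset_of_inter_nonempty hφ hφzero hφadd isClosed_closure
    ((isPosInvariant_forwardOrbit hφadd x).closure hφ)
    ⟨x, hx, subset_closure (mem_forwardOrbit_self hφzero x)⟩

theorem IsCompactMinimalSet.eq_of_mem {Γ Δ : Set M} (hΓ : IsCompactMinimalSet φ Γ)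
    (hΔ : IsCompactMinimalSet φ Δ) {x : M} (hxΓ : x ∈ Γ) (hxΔ : x ∈ Δ) : Γ = Δ := by
  have hinv : IsFlowInvariant φ (Γ ∩ Δ) := fun y hy t =>
    ⟨hΓ.2.2.1 y hy.1 t, hΔ.2.2.1 y hy.2 t⟩
  have hcl : IsClosed (Γ ∩ Δ) := hΓ.2.1.isClosed.inter hΔ.2.1.isClosed
  exact (hΓ.2.2.2 _ inter_subset_left ⟨x, hxΓ, hxΔ⟩ hcl hinv).symm.trans
    (hΔ.2.2.2 _ inter_subset_right ⟨x, hxΓ, hxΔ⟩ hcl hinv)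

theorem IsCompactMinimalSet.isConnected (hφcont : Continuous fun p : ℝ × M => φ p.1 p.2)
    (hφzero : ∀ x : M, φ 0 x = x)
    (hφadd : ∀ s t : ℝ, ∀ x : M, φ s (φ t x) = φ (s + t) x)
    {Γ : Set M} (hΓ : IsCompactMinimalSet φ Γ) : IsConnected Γ := by
  obtain ⟨x, hx⟩ := hΓ.1
  have horb : IsConnected (forwardOrbit φ x) :=
    isConnected_Ici.image _ (hφcont.comp (Continuous.prodMk_left x)).continuousOn
  exact horb.subset_closure (hΓ.2.2.1.isPosInvariant.forwardOrbit_subset hx)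
    (hΓ.subset_closure_forwardOrbit (fun t => hφcont.comp (Continuous.prodMk_right t))
      hφzero hφadd hx)

/-- Compact minimal sets close to a Lyapunov stable one are close in the Hausdorff metric. -/
theorem IsLyapunovStable.exists_nhdsSet_forall_mem (hφ : ∀ t, Continuous (φ t))
    (hφzero : ∀ x : M, φ 0 x = x)
    (hφadd : ∀ s t : ℝ, ∀ x : M, φ s (φ t x) = φ (s + t) x)
    {Γ : NonemptyCompacts M} (hstable : IsLyapunovStable φ (Γ : Set M))
    (hΓ : IsCompactMinimalSet φ (Γ : Set M)) {O : Set (NonemptyCompacts M)} (hO : O ∈ 𝓝 Γ) :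
    ∃ W ∈ 𝓝ˢ (Γ : Set M), ∀ Δ : NonemptyCompacts M, IsCompactMinimalSet φ (Δ : Set M) →
      ((Δ : Set M) ∩ W).Nonempty → Δ ∈ O := by
  obtain ⟨_, ⟨u, ⟨hufin, -, huo⟩, rfl⟩, ⟨hΓu, hΓU⟩, hsub⟩ :=
    NonemptyCompacts.isTopologicalBasis.mem_nhds_iff.1 hO
  obtain ⟨G, hGo, hΓG, hGcl⟩ :=
    normal_exists_closure_subset Γ.isCompact.isClosed (isOpen_sUnion huo) hΓu
  obtain ⟨V, hV, hVG, hVpos⟩ := hstable G (hGo.mem_nhdsSet.2 hΓG)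
  refine ⟨V ∩ ⋂ U ∈ u, ⋃ t, φ t ⁻¹' U, inter_mem hV ?_, fun Δ hΔ hne => hsub ⟨?_, ?_⟩⟩
  · refine (biInter_mem hufin).2 fun U hU => ?_
    refine (isOpen_iUnion fun t => (huo U hU).preimage (hφ t)).mem_nhdsSet.2 fun x hx => ?_
    obtain ⟨y, hyΓ, hyU⟩ := hΓU U hU
    obtain ⟨_, hzU, t, -, rfl⟩ := mem_closure_iff.1
      (hΓ.subset_closure_forwardOrbit hφ hφzero hφadd hx hyΓ) U (huo U hU) hyU
    exact mem_iUnion.2 ⟨t, hzU⟩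
  · obtain ⟨x, hxΔ, hxV, -⟩ := hne
    exact (hΔ.subset_of_inter_nonempty hφ hφzero hφadd isClosed_closure (hVpos.closure hφ)
      ⟨x, hxΔ, subset_closure hxV⟩).trans ((closure_mono hVG).trans hGcl)
  · intro U hU
    obtain ⟨x, hxΔ, -, hx⟩ := hne
    obtain ⟨t, ht⟩ := mem_iUnion.1 (mem_iInter₂.1 hx U hU)
    exact ⟨φ t x, hΔ.2.2.1 x hxΔ t, ht⟩

/-- Under a non-wandering flow, a forward orbit accumulating on a Lyapunov stable compact
invariant set already lies in it. -/
theorem IsLyapunovStable.mem_of_closure_forwardOrbit (hφ : ∀ t, Continuous (φ t))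
    (hφadd : ∀ s t : ℝ, ∀ x : M, φ s (φ t x) = φ (s + t) x)
    (hnw : IsNonWanderingFlow φ) {Γ : Set M} (hstable : IsLyapunovStable φ Γ)
    (hΓcl : IsClosed Γ) {x : M} (hx : (Γ ∩ closure (forwardOrbit φ x)).Nonempty) : x ∈ Γ := by
  by_contra hxΓ
  obtain ⟨G, hGo, hΓG, hGcl⟩ := normal_exists_closure_subset hΓcl
    (isOpen_compl_singleton (x := x)) (subset_compl_singleton_iff.2 hxΓ)
  obtain ⟨V, hV, hVG, hVpos⟩ := hstable G (hGo.mem_nhdsSet.2 hΓG)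
  obtain ⟨y, hyΓ, hy⟩ := hx
  obtain ⟨_, hsV, s, hs, rfl⟩ := mem_closure_iff.1 hy (interior V) isOpen_interior
    (subset_interior_iff_mem_nhdsSet.2 hV hyΓ)
  have hN : φ s ⁻¹' interior V ∩ (closure G)ᶜ ∈ 𝓝 x :=
    ((isOpen_interior.preimage (hφ s)).inter isClosed_closure.isOpen_compl).mem_nhds
      ⟨hsV, fun h => hGcl h rfl⟩
  have hs' : (0 : ℝ) ≤ s := hs
  obtain ⟨t, ht, _, ⟨z, hz, rfl⟩, hzN⟩ := hnw x _ hN (s + 1) (by linarith)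
  have hzV := hVpos _ (interior_subset hz.1) (t - s) (by linarith)
  rw [hφadd, sub_add_cancel] at hzV
  exact hzN.2 (subset_closure (hVG hzV))

theorem IsHyperStable.isLyapunovStable_s17 {Γ : Set M} (h : IsHyperStable φ Γ) :
    IsLyapunovStable φ Γ := by
  by_contra hun
  obtain ⟨hΓ, W, hW, hWΓ⟩ := h
  obtain ⟨x, hx⟩ := hΓ.1
  have : x ∈ Γ ∩ W := ⟨hx, subset_of_mem_nhdsSet hW hx⟩
  rwa [hWΓ Γ hΓ hun] at this

/-- Under a non-wandering flow on a locally compact space, the points near a hyper-stable compact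
minimal set lie on hyper-stable compact minimal sets. -/
theorem IsHyperStable.eventually_nhdsSet [LocallyCompactSpace M] (hφ : ∀ t, Continuous (φ t))
    (hφzero : ∀ x : M, φ 0 x = x)
    (hφadd : ∀ s t : ℝ, ∀ x : M, φ s (φ t x) = φ (s + t) x)
    (hnw : IsNonWanderingFlow φ) {Γ : Set M} (h : IsHyperStable φ Γ) :
    ∀ᶠ x in 𝓝ˢ Γ, ∃ Δ : Set M, IsHyperStable φ Δ ∧ x ∈ Δ := by
  obtain ⟨W, hW, hWΓ⟩ := h.2
  obtain ⟨G, hGo, hΓG, hGW, hGc⟩ := exists_open_between_and_isCompact_closure h.1.2.1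
    isOpen_interior (subset_interior_iff_mem_nhdsSet.2 hW)
  obtain ⟨V, hV, hVG, hVpos⟩ := h.isLyapunovStable_s17 G (hGo.mem_nhdsSet.2 hΓG)
  filter_upwards [hV] with x hx
  have horb : closure (forwardOrbit φ x) ⊆ closure G :=
    closure_mono ((hVpos.forwardOrbit_subset hx).trans hVG)
  obtain ⟨Δ, hΔsub, hΔ⟩ :=
    ((isPosInvariant_forwardOrbit hφadd x).closure hφ).exists_isCompactMinimalSet hφ hφzero hφadd
      (hGc.of_isClosed_subset isClosed_closure horb)
      ⟨x, subset_closure (mem_forwardOrbit_self hφzero x)⟩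
  have hΔW : W ∈ 𝓝ˢ Δ := subset_interior_iff_mem_nhdsSet.1 ((hΔsub.trans horb).trans hGW)
  have hΔhs : IsHyperStable φ Δ := ⟨hΔ, W, hΔW, hWΓ⟩
  obtain ⟨y, hy⟩ := hΔ.1
  exact ⟨Δ, hΔhs, hΔhs.isLyapunovStable_s17.mem_of_closure_forwardOrbit hφ hφadd hnw
    hΔ.2.1.isClosed ⟨y, hy, hΔsub hy⟩⟩

/-- The union of the hyper-stable compact minimal sets. -/
def hyperStableLocus (φ : ℝ → M → M) : Set M :=
  {x | ∃ p : ↥(HSset φ), x ∈ (p : NonemptyCompacts M)}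

/-- The map sending a point of the hyper-stable locus to the minimal set through it. -/
noncomputable def hyperStableProj (φ : ℝ → M → M) (x : ↥(hyperStableLocus φ)) : ↥(HSset φ) :=
  x.2.choose

theorem hyperStableProj_eq_iff {x : ↥(hyperStableLocus φ)} {p : ↥(HSset φ)} :
    hyperStableProj φ x = p ↔ (x : M) ∈ (p : NonemptyCompacts M) := by
  have hx : (x : M) ∈ (hyperStableProj φ x : NonemptyCompacts M) := x.2.choose_spec
  refine ⟨fun h => h ▸ hx, fun h => Subtype.ext (SetLike.coe_injective ?_)⟩
  exact (hyperStableProj φ x).2.1.eq_of_mem p.2.1 hx h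

theorem unionSet_eq_image_preimage (X : Set ↥(HSset φ)) :
    unionSet φ X = Subtype.val '' (hyperStableProj φ ⁻¹' X) := by
  ext x
  constructor
  · rintro ⟨p, hp, hx⟩
    refine ⟨⟨x, p, hx⟩, ?_, rfl⟩
    rwa [mem_preimage, hyperStableProj_eq_iff.2 hx]
  · rintro ⟨y, hy, rfl⟩
    exact ⟨_, hy, hyperStableProj_eq_iff.1 rfl⟩

theorem isConnected_unionSet_iff {X : Set ↥(HSset φ)} :
    IsConnected (unionSet φ X) ↔ IsConnected (hyperStableProj φ ⁻¹' X) := by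
  rw [unionSet_eq_image_preimage, IsConnected, IsConnected, image_nonempty,
    IsInducing.subtypeVal.isPreconnected_image]

theorem isFlowInvariant_unionSet (X : Set ↥(HSset φ)) : IsFlowInvariant φ (unionSet φ X) := by
  rintro x ⟨p, hp, hx⟩ t
  exact ⟨p, hp, p.2.1.2.2.1 x hx t⟩

theorem isConnected_hyperStableProj_fiber (hφcont : Continuous fun p : ℝ × M => φ p.1 p.2)
    (hφzero : ∀ x : M, φ 0 x = x)
    (hφadd : ∀ s t : ℝ, ∀ x : M, φ s (φ t x) = φ (s + t) x) (p : ↥(HSset φ)) :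
    IsConnected (hyperStableProj φ ⁻¹' {p}) := by
  rw [← isConnected_unionSet_iff]
  simpa [unionSet] using p.2.1.isConnected hφcont hφzero hφadd

theorem isOpen_hyperStableLocus [LocallyCompactSpace M] (hφ : ∀ t, Continuous (φ t))
    (hφzero : ∀ x : M, φ 0 x = x)
    (hφadd : ∀ s t : ℝ, ∀ x : M, φ s (φ t x) = φ (s + t) x)
    (hnw : IsNonWanderingFlow φ) : IsOpen (hyperStableLocus φ) := by
  refine isOpen_iff_mem_nhds.2 ?_
  rintro x ⟨p, hx⟩
  filter_upwards [(p.2.eventually_nhdsSet hφ hφzero hφadd hnw).filter_mono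
    (nhds_le_nhdsSet hx)]
  rintro y ⟨Δ, hΔ, hy⟩
  exact ⟨⟨⟨⟨Δ, hΔ.1.2.1⟩, hΔ.1.1⟩, hΔ⟩, hy⟩

theorem isOpenQuotientMap_hyperStableProj (hφ : ∀ t, Continuous (φ t))
    (hφzero : ∀ x : M, φ 0 x = x)
    (hφadd : ∀ s t : ℝ, ∀ x : M, φ s (φ t x) = φ (s + t) x) :
    IsOpenQuotientMap (hyperStableProj φ) where
  surjective p := by
    obtain ⟨x, hx⟩ := p.2.1.1
    exact ⟨⟨x, p, hx⟩, hyperStableProj_eq_iff.2 hx⟩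
  continuous := by
    refine continuous_iff_continuousAt.2 fun x => tendsto_subtype_rng.2 fun O hO => ?_
    obtain ⟨W, hW, hWO⟩ := (hyperStableProj φ x).2.isLyapunovStable_s17.exists_nhdsSet_forall_mem
      hφ hφzero hφadd (hyperStableProj φ x).2.1 hO
    have hWx : W ∈ 𝓝 (x : M) := nhds_le_nhdsSet (hyperStableProj_eq_iff.1 rfl) hW
    rw [mem_map]
    filter_upwards [continuous_subtype_val.continuousAt.preimage_mem_nhds hWx] with y hy
    exact hWO _ (hyperStableProj φ y).2.1 ⟨y, hyperStableProj_eq_iff.1 rfl, hy⟩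
  isOpenMap := by
    rintro _ ⟨O, hO, rfl⟩
    convert (NonemptyCompacts.isOpen_inter_nonempty_of_isOpen hO).preimage
      (continuous_subtype_val (p := (· ∈ HSset φ))) using 1
    ext p
    constructor
    · rintro ⟨x, hx, rfl⟩
      exact ⟨x, hyperStableProj_eq_iff.1 rfl, hx⟩
    · rintro ⟨x, hxp, hx⟩
      exact ⟨⟨x, p, hxp⟩, hx, hyperStableProj_eq_iff.2 hxp⟩

theorem nwAlt1_of_hsSet_eq_empty (hφ : ∀ t, Continuous (φ t))
    (hφzero : ∀ x : M, φ 0 x = x)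
    (hφadd : ∀ s t : ℝ, ∀ x : M, φ s (φ t x) = φ (s + t) x) (h : HSset φ = ∅) : NWAlt1 φ := by
  refine ⟨h, fun Γ hΓ => mem_closure_iff_nhds.2 fun O hO => ?_⟩
  by_cases hstable : IsLyapunovStable φ (Γ : Set M)
  · obtain ⟨W, hW, hWO⟩ := hstable.exists_nhdsSet_forall_mem hφ hφzero hφadd hΓ hO
    by_contra hne
    refine (h ▸ notMem_empty Γ : Γ ∉ HSset φ) ⟨hΓ, W, hW, fun Δ hΔ hun => ?_⟩
    by_contra hΔW
    exact hne ⟨⟨⟨Δ, hΔ.2.1⟩, hΔ.1⟩, hWO _ hΔ (nonempty_iff_ne_empty.2 hΔW), hΔ, hun⟩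
  · exact ⟨Γ, mem_of_mem_nhds hO, hΓ, hstable⟩

theorem nwAlt2_of_isOpen [ConnectedSpace M] (hφ : ∀ t, Continuous (φ t))
    (hφzero : ∀ x : M, φ 0 x = x)
    (hφadd : ∀ s t : ℝ, ∀ x : M, φ s (φ t x) = φ (s + t) x) (p : ↥(HSset φ))
    (hp : IsOpen ((p : NonemptyCompacts M) : Set M)) : NWAlt2 φ := by
  have huniv : ((p : NonemptyCompacts M) : Set M) = univ :=
    IsClopen.eq_univ ⟨p.2.1.2.1.isClosed, hp⟩ p.2.1.1
  refine ⟨isCompact_univ_iff.1 (huniv ▸ p.2.1.2.1), fun x y => ?_, Subset.antisymm ?_ ?_⟩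
  · exact closure_mono (image_subset_range _ _)
      (p.2.1.subset_closure_forwardOrbit hφ hφzero hφadd (huniv ▸ mem_univ x)
        (huniv ▸ mem_univ y))
  · intro Γ hΓ
    obtain ⟨x, hx⟩ := hΓ.1.1
    exact (hΓ.1.eq_of_mem p.2.1 hx (huniv ▸ mem_univ x)).trans huniv
  · intro Γ hΓ
    have : Γ = p := SetLike.coe_injective (hΓ.trans huniv.symm)
    exact this ▸ p.2

theorem nwAlt2_or_nwAlt3 [LocallyCompactSpace M] [ConnectedSpace M] [LocallyConnectedSpace M]
    (hφcont : Continuous fun p : ℝ × M => φ p.1 p.2)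
    (hφzero : ∀ x : M, φ 0 x = x)
    (hφadd : ∀ s t : ℝ, ∀ x : M, φ s (φ t x) = φ (s + t) x)
    (hnw : IsNonWanderingFlow φ) (hne : (HSset φ).Nonempty) : NWAlt2 φ ∨ NWAlt3 φ := by
  have hφ : ∀ t, Continuous (φ t) := fun t => hφcont.comp (Continuous.prodMk_right t)
  have hlocus := isOpen_hyperStableLocus hφ hφzero hφadd hnw
  have hquot := isOpenQuotientMap_hyperStableProj hφ hφzero hφadd
  have := hlocus.locallyConnectedSpace
  have := hlocus.locallyCompactSpace
  have := hquot.locallyCompactSpace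
  have : LocallyConnectedSpace ↥(HSset φ) :=
    hquot.isQuotientMap.isCoinducing.locallyConnectedSpace
  have := separableSpace_of_connectedSpace_of_locallyCompactSpace (M := M)
  have := UniformSpace.secondCountable_of_separable M
  have : SeparableSpace ↥(HSset φ) := hquot.surjective.denseRange.separableSpace hquot.continuous
  have hopen : ∀ p : ↥(HSset φ), IsOpen (unionSet φ (connectedComponent p)) := fun p => by
    rw [unionSet_eq_image_preimage]
    exact hlocus.isOpenMap_subtype_val _ (isOpen_connectedComponent.preimage hquot.continuous)
  refine or_iff_not_imp_left.2 fun hnot => ⟨hne, ?_, fun p => ?_⟩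
  · refine PairwiseDisjoint.countable_of_isOpen (s := id) ?_ ?_ ?_
    · rintro _ ⟨p, rfl⟩ _ ⟨q, rfl⟩ hpq
      exact connectedComponent_disjoint hpq
    · rintro _ ⟨p, rfl⟩
      exact isOpen_connectedComponent
    · rintro _ ⟨p, rfl⟩
      exact ⟨p, mem_connectedComponent⟩
  · have hconn : IsConnected (unionSet φ (connectedComponent p)) := by
      rw [isConnected_unionSet_iff]
      exact hquot.isQuotientMap.isCoinducing.isConnected_preimage_of_isClosed
        (isConnected_hyperStableProj_fiber hφcont hφzero hφadd) isClosed_connectedComponent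
        isConnected_connectedComponent
    refine ⟨isClopen_connectedComponent, isClopen_connectedComponent.isOpen.locallyCompactSpace,
      isConnected_iff_connectedSpace.1 isConnected_connectedComponent,
      isClopen_connectedComponent.isOpen.locallyConnectedSpace, ?_, hconn.nonempty, hconn, hopen p,
      isFlowInvariant_unionSet _⟩
    by_contra hnt
    have hsing : connectedComponent p = {p} :=
      (not_nontrivial_iff.1 hnt).eq_singleton_of_mem mem_connectedComponent
    refine hnot (nwAlt2_of_isOpen hφ hφzero hφadd p ?_)
    simpa [unionSet, hsing] using hopen p

theorem not_nwAlt2_and_nwAlt3 : ¬ (NWAlt2 φ ∧ NWAlt3 φ) := by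
  rintro ⟨⟨-, -, hHS⟩, ⟨Γ, hΓ⟩, -, h⟩
  obtain ⟨p, -, q, -, hpq⟩ := (h ⟨Γ, hΓ⟩).2.2.2.2.1
  have huniv : ∀ r : ↥(HSset φ), ((r : NonemptyCompacts M) : Set M) = univ := fun r =>
    hHS.subset r.2
  exact hpq (Subtype.ext (SetLike.coe_injective ((huniv p).trans (huniv q).symm)))

theorem not_nwAlt1_and_nwAlt2 [Nonempty M] : ¬ (NWAlt1 φ ∧ NWAlt2 φ) := by
  rintro ⟨⟨hempty, -⟩, _, -, hHS⟩
  have : (⊤ : NonemptyCompacts M) ∈ HSset φ := hHS ▸ NonemptyCompacts.coe_top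
  exact (hempty ▸ this : _ ∈ (∅ : Set (NonemptyCompacts M)))

end Flow

/-- Global structure of `HS` for non-wandering flows: exactly one of the three
alternatives holds. -/
theorem nonwandering_global_trichotomy
    [LocallyCompactSpace M] [ConnectedSpace M] [LocallyConnectedSpace M]
    (φ : ℝ → M → M)
    (hφcont : Continuous fun p : ℝ × M => φ p.1 p.2)
    (hφzero : ∀ x : M, φ 0 x = x)
    (hφadd : ∀ s t : ℝ, ∀ x : M, φ s (φ t x) = φ (s + t) x)
    (hnw : IsNonWanderingFlow φ) :
    (NWAlt1 φ ∨ NWAlt2 φ ∨ NWAlt3 φ) ∧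
      ¬ (NWAlt1 φ ∧ NWAlt2 φ) ∧ ¬ (NWAlt1 φ ∧ NWAlt3 φ) ∧ ¬ (NWAlt2 φ ∧ NWAlt3 φ) := by
  have hφ : ∀ t, Continuous (φ t) := fun t => hφcont.comp (Continuous.prodMk_right t)
  refine ⟨?_, not_nwAlt1_and_nwAlt2, fun h => h.2.1.ne_empty h.1.1, not_nwAlt2_and_nwAlt3⟩
  rcases (HSset φ).eq_empty_or_nonempty with hempty | hne
  · exact .inl (nwAlt1_of_hsSet_eq_empty hφ hφzero hφadd hempty)
  · exact .inr (nwAlt2_or_nwAlt3 hφcont hφzero hφadd hnw hne)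
end

section
/- Let φ be a flow on a Peano continuum M (a compact, connected, locally connected metric space) having no Lyapunov unstable compact minimal set. Then every point of M is recurrent (x ∈ ω(x) for all x ∈ M), the flow is non-wandering, and either (1) the flow is minimal (every orbit is dense in M), or (2) M is partitioned into compact minimal sets, all of which are hyper-stable; the set CMin of compact minimal sets, with the Hausdorff metric, is a compact, connected, locally connected metric space with exactly continuum-many elements; and every nonempty open subset of M meets continuum-many distinct compact minimal sets. -/
open Set Filter Topology Metric TopologicalSpace

variable {M : Type*} [MetricSpace M]

/-- A continuous action of `ℝ` given as a map `ℝ → M → M`. -/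
structure IsContinuousFlow (φ : ℝ → M → M) : Prop where
  continuous : Continuous fun p : ℝ × M => φ p.1 p.2
  zero : ∀ x, φ 0 x = x
  add : ∀ s t x, φ s (φ t x) = φ (s + t) x

namespace IsContinuousFlow

variable {φ : ℝ → M → M}

theorem continuous_time (h : IsContinuousFlow φ) (t : ℝ) : Continuous (φ t) :=
  h.continuous.comp (Continuous.prodMk_right t)

theorem neg_apply (h : IsContinuousFlow φ) (t : ℝ) (x : M) : φ (-t) (φ t x) = x := by
  rw [h.add, neg_add_cancel, h.zero]

/-- The time-reversed flow. -/
theorem reverse (h : IsContinuousFlow φ) : IsContinuousFlow fun t => φ (-t) where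
  continuous := h.continuous.comp ((continuous_fst.neg).prodMk continuous_snd)
  zero x := by simp [h.zero]
  add s t x := by rw [h.add, neg_add]

theorem isClosed_omegaLimitSet (φ : ℝ → M → M) (x : M) : IsClosed (omegaLimitSet φ x) :=
  isClosed_biInter fun _ _ => isClosed_closure

theorem nonempty_omegaLimitSet [CompactSpace M] (φ : ℝ → M → M) (x : M) :
    (omegaLimitSet φ x).Nonempty := by
  obtain ⟨z, hz⟩ := exists_clusterPt_of_compactSpace (map (fun t => φ t x) atTop)
  refine ⟨z, mem_iInter₂.2 fun T _ => ?_⟩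
  exact hz.mem_closure_of_mem _ (image_mem_map (Ici_mem_atTop T))

theorem isFlowInvariant_omegaLimitSet (h : IsContinuousFlow φ) (x : M) :
    IsFlowInvariant φ (omegaLimitSet φ x) := by
  intro z hz s
  refine mem_iInter₂.2 fun T _ => ?_
  have hz' := mem_iInter₂.1 hz (max 0 (T - s)) (mem_Ici.2 (le_max_left _ _))
  refine map_mem_closure (h.continuous_time s) hz' ?_
  rintro _ ⟨t, ht, rfl⟩
  refine ⟨s + t, ?_, (h.add s t x).symm⟩
  have := (le_max_right 0 (T - s)).trans ht
  simp only [mem_Ici]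
  linarith

theorem exists_isCompactMinimalSet_subset [CompactSpace M] {K : Set M}
    (hne : K.Nonempty) (hcl : IsClosed K) (hinv : IsFlowInvariant φ K) :
    ∃ Λ ⊆ K, IsCompactMinimalSet φ Λ := by
  obtain ⟨Λ, hΛK, hΛ⟩ := zorn_superset_nonempty
    {K : Set M | K.Nonempty ∧ IsClosed K ∧ IsFlowInvariant φ K} (fun c hc hchain hcne => by
      refine ⟨⋂₀ c, ⟨?_, isClosed_sInter fun s hs => (hc hs).2.1,
        fun x hx t => mem_sInter.2 fun s hs => (hc hs).2.2 x (mem_sInter.1 hx s hs) t⟩,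
        fun s hs => sInter_subset_of_mem hs⟩
      have := hcne.to_subtype
      rw [sInter_eq_iInter]
      exact IsCompact.nonempty_iInter_of_directed_nonempty_isCompact_isClosed _
        (DirectedOn.directed_val (IsChain.directedOn hchain.symm))
        (fun s => (hc s.2).1) (fun s => (hc s.2).2.1.isCompact) fun s => (hc s.2).2.1)
    K ⟨hne, hcl, hinv⟩
  refine ⟨Λ, hΛK, hΛ.prop.1, hΛ.prop.2.1.isCompact, hΛ.prop.2.2, fun K' hK' h1 h2 h3 => ?_⟩
  exact hΛ.eq_of_subset ⟨h1, h2, h3⟩ hK'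

/-- The closure of the orbit of a point. -/
def orbitClosure (φ : ℝ → M → M) (x : M) : Set M := closure (range fun t => φ t x)

theorem isCompact_orbitClosure [CompactSpace M] (φ : ℝ → M → M) (x : M) :
    IsCompact (orbitClosure φ x) :=
  isClosed_closure.isCompact

theorem mem_orbitClosure (h : IsContinuousFlow φ) (x : M) : x ∈ orbitClosure φ x :=
  subset_closure ⟨0, h.zero x⟩

theorem isFlowInvariant_orbitClosure (h : IsContinuousFlow φ) (x : M) :
    IsFlowInvariant φ (orbitClosure φ x) := by
  intro z hz s
  refine map_mem_closure (h.continuous_time s) hz ?_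
  rintro _ ⟨t, rfl⟩
  exact ⟨s + t, (h.add s t x).symm⟩

theorem orbitClosure_subset {K : Set M} (hcl : IsClosed K) (hinv : IsFlowInvariant φ K) {x : M}
    (hx : x ∈ K) : orbitClosure φ x ⊆ K := by
  refine closure_minimal ?_ hcl
  rintro _ ⟨t, rfl⟩
  exact hinv x hx t

theorem orbitClosure_eq (h : IsContinuousFlow φ) {K : Set M} (hK : IsCompactMinimalSet φ K) {x : M}
    (hx : x ∈ K) : orbitClosure φ x = K :=
  hK.2.2.2 _ (orbitClosure_subset hK.2.1.isClosed hK.2.2.1 hx) ⟨x, h.mem_orbitClosure x⟩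
    isClosed_closure (h.isFlowInvariant_orbitClosure x)

/-- If all compact minimal sets are Lyapunov stable, then they cover the space: a point belongs to
every compact minimal set on which its backward orbit accumulates. -/
theorem exists_isCompactMinimalSet_mem [CompactSpace M] (h : IsContinuousFlow φ)
    (hstab : ∀ K : Set M, IsCompactMinimalSet φ K → IsLyapunovStable φ K) (x : M) :
    ∃ K, IsCompactMinimalSet φ K ∧ x ∈ K := by
  have hinv : IsFlowInvariant φ (omegaLimitSet (fun t => φ (-t)) x) := fun z hz t => by
    simpa using h.reverse.isFlowInvariant_omegaLimitSet x z hz (-t)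
  obtain ⟨Λ, hΛx, hΛ⟩ := exists_isCompactMinimalSet_subset
    (nonempty_omegaLimitSet _ x) (isClosed_omegaLimitSet _ x) hinv
  refine ⟨Λ, hΛ, by_contra fun hx => ?_⟩
  obtain ⟨V, hV, hVx, hVpos⟩ := hstab Λ hΛ {x}ᶜ
    (isOpen_compl_singleton.mem_nhdsSet.2 fun y hy hyx => hx (hyx ▸ hy))
  obtain ⟨z, hz⟩ := hΛ.1
  obtain ⟨_, hwV, t, ht, rfl⟩ := mem_closure_iff_nhds.1
    (mem_iInter₂.1 (hΛx hz) 0 self_mem_Ici) V (mem_nhdsSet_iff_forall.1 hV z hz)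
  have := hVpos _ hwV t ht
  simp only [h.add, add_neg_cancel, h.zero] at this
  exact hVx this rfl

section Stable

variable [CompactSpace M]

theorem isCompactMinimalSet_orbitClosure (h : IsContinuousFlow φ)
    (hstab : ∀ K : Set M, IsCompactMinimalSet φ K → IsLyapunovStable φ K) (x : M) :
    IsCompactMinimalSet φ (orbitClosure φ x) := by
  obtain ⟨K, hK, hx⟩ := h.exists_isCompactMinimalSet_mem hstab x
  rwa [h.orbitClosure_eq hK hx]

theorem omegaLimitSet_eq_orbitClosure (h : IsContinuousFlow φ) {x : M}
    (hx : IsCompactMinimalSet φ (orbitClosure φ x)) :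
    omegaLimitSet φ x = orbitClosure φ x :=
  hx.2.2.2 _ ((biInter_subset_of_mem self_mem_Ici).trans (closure_mono (image_subset_range _ _)))
    (nonempty_omegaLimitSet φ x) (isClosed_omegaLimitSet φ x) (h.isFlowInvariant_omegaLimitSet x)

/-- The closure of the orbit of a point, as a nonempty compact set. -/
def orbitHull (h : IsContinuousFlow φ) (x : M) : NonemptyCompacts M where
  carrier := orbitClosure φ x
  isCompact' := isCompact_orbitClosure φ x
  nonempty' := ⟨x, h.mem_orbitClosure x⟩

@[simp]
theorem coe_orbitHull (h : IsContinuousFlow φ) (x : M) :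
    (h.orbitHull x : Set M) = orbitClosure φ x := rfl

theorem orbitHull_eq (h : IsContinuousFlow φ) {Γ : NonemptyCompacts M}
    (hΓ : IsCompactMinimalSet φ (Γ : Set M)) {x : M} (hx : x ∈ (Γ : Set M)) :
    h.orbitHull x = Γ :=
  NonemptyCompacts.ext (h.orbitClosure_eq hΓ hx)

theorem continuous_orbitHull (h : IsContinuousFlow φ)
    (hstab : ∀ K : Set M, IsCompactMinimalSet φ K → IsLyapunovStable φ K) :
    Continuous h.orbitHull := by
  rw [continuous_iff_continuousAt]
  intro x
  rw [ContinuousAt, Metric.tendsto_nhds]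
  intro ε hε
  have upper : ∀ᶠ y in 𝓝 x, orbitClosure φ y ⊆ cthickening (ε / 2) (orbitClosure φ x) := by
    obtain ⟨V, hV, hVU, hVpos⟩ := hstab _ (h.isCompactMinimalSet_orbitClosure hstab x)
      (cthickening (ε / 2) (orbitClosure φ x)) (cthickening_mem_nhdsSet _ (half_pos hε))
    filter_upwards [mem_nhdsSet_iff_forall.1 hV x (h.mem_orbitClosure x)] with y hy
    rw [← h.omegaLimitSet_eq_orbitClosure (h.isCompactMinimalSet_orbitClosure hstab y)]
    refine (biInter_subset_of_mem self_mem_Ici).trans (closure_minimal ?_ isClosed_cthickening)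
    rintro _ ⟨t, ht, rfl⟩
    exact hVU (hVpos y hy t ht)
  have lower : ∀ᶠ y in 𝓝 x, ∀ z ∈ orbitClosure φ x, ∃ w ∈ orbitClosure φ y, dist z w ≤ ε / 2 := by
    obtain ⟨b, -, hbfin, hcov⟩ :=
      (isCompact_orbitClosure φ x).elim_finite_subcover_image
      (b := univ) (c := fun t : ℝ => ball (φ t x) (ε / 4)) (fun _ _ => isOpen_ball) (by
        intro z hz
        obtain ⟨_, ⟨t, rfl⟩, ht⟩ := Metric.mem_closure_iff.1 hz (ε / 4) (by positivity)
        exact mem_biUnion (mem_univ t) ht)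
    have hnear : ∀ᶠ y in 𝓝 x, ∀ t ∈ b, dist (φ t y) (φ t x) < ε / 4 :=
      (eventually_all_finite hbfin).2 fun t _ =>
        Metric.tendsto_nhds.1 (h.continuous_time t).continuousAt _ (by positivity)
    filter_upwards [hnear] with y hy z hz
    obtain ⟨t, ht, hzt⟩ := mem_iUnion₂.1 (hcov hz)
    refine ⟨φ t y, subset_closure ⟨t, rfl⟩, ?_⟩
    have h1 := hy t ht
    have h2 := mem_ball.1 hzt
    have h3 := dist_triangle_right z (φ t y) (φ t x)
    linarith
  filter_upwards [upper, lower] with y hu hl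
  rw [NonemptyCompacts.dist_eq]
  refine (hausdorffDist_le_of_mem_dist (half_pos hε).le (fun z hz => ?_) hl).trans_lt
    (half_lt_self hε)
  have hz' := hu hz
  rw [(isCompact_orbitClosure φ x).cthickening_eq_biUnion_closedBall (half_pos hε).le] at hz'
  obtain ⟨w, hw, hzw⟩ := mem_iUnion₂.1 hz'
  exact ⟨w, hw, hzw⟩

theorem range_orbitHull (h : IsContinuousFlow φ)
    (hstab : ∀ K : Set M, IsCompactMinimalSet φ K → IsLyapunovStable φ K) :
    range h.orbitHull = CMinSet φ := by
  ext Γ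
  constructor
  · rintro ⟨x, rfl⟩
    exact h.isCompactMinimalSet_orbitClosure hstab x
  · intro hΓ
    obtain ⟨x, hx⟩ := Γ.nonempty
    exact ⟨x, h.orbitHull_eq hΓ hx⟩

theorem image_orbitHull (h : IsContinuousFlow φ)
    (hstab : ∀ K : Set M, IsCompactMinimalSet φ K → IsLyapunovStable φ K) (A : Set M) :
    h.orbitHull '' A =
      {Γ : NonemptyCompacts M | IsCompactMinimalSet φ (Γ : Set M) ∧ ((Γ : Set M) ∩ A).Nonempty} := by
  ext Γ
  constructor
  · rintro ⟨x, hx, rfl⟩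
    exact ⟨h.isCompactMinimalSet_orbitClosure hstab x, x, h.mem_orbitClosure x, hx⟩
  · rintro ⟨hΓ, x, hx, hxA⟩
    exact ⟨x, hxA, h.orbitHull_eq hΓ hx⟩

end Stable

/-- In a connected space, a compact minimal set with nonempty interior is the whole space. -/
theorem eq_univ_of_isCompactMinimalSet [ConnectedSpace M] (h : IsContinuousFlow φ) {K U : Set M}
    (hK : IsCompactMinimalSet φ K) (hU : IsOpen U) (hne : U.Nonempty) (hUK : U ⊆ K) :
    K = univ := by
  have hint : K \ interior K = ∅ := by
    by_contra hdiff
    have heq := hK.2.2.2 (K \ interior K) sdiff_subset (nonempty_iff_ne_empty.2 hdiff)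
      (hK.2.1.isClosed.sdiff isOpen_interior) fun x hx t => ⟨hK.2.2.1 x hx.1 t, fun hxt => hx.2 ?_⟩
    · obtain ⟨u, hu⟩ := hne
      exact (heq.symm ▸ hUK hu : u ∈ K \ interior K).2 (interior_maximal hUK hU hu)
    · refine interior_maximal (t := φ t ⁻¹' interior K) (fun y hy => ?_)
        (isOpen_interior.preimage (h.continuous_time t)) hxt
      simpa only [h.neg_apply] using hK.2.2.1 _ (interior_subset hy) (-t)
  have hopen : IsOpen K := by
    rw [← interior_eq_iff_isOpen]
    exact interior_subset.antisymm (sdiff_eq_empty.1 hint)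
  exact IsClopen.eq_univ ⟨hK.2.1.isClosed, hopen⟩ hK.1

end IsContinuousFlow

theorem Cardinal.mk_le_continuum_of_secondCountable (X : Type*) [TopologicalSpace X] [T0Space X]
    [SecondCountableTopology X] : Cardinal.mk X ≤ Cardinal.continuum := by
  have hinj : Function.Injective
      fun x : X => {B : countableBasis X | x ∈ (B : Set X)} := by
    intro x y hxy
    refine (isBasis_countableBasis X).eq_iff.2 fun s hs => ?_
    simpa using Set.ext_iff.1 hxy ⟨s, hs⟩
  refine (Cardinal.mk_le_of_injective hinj).trans ?_
  rw [Cardinal.mk_set, ← Cardinal.two_power_aleph0]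
  exact Cardinal.power_le_power_left two_ne_zero
    (Cardinal.mk_le_aleph0_iff.2 (countable_countableBasis X))

theorem IsPreconnected.continuum_le_mk {X : Type*} [MetricSpace X] {s : Set X}
    (hs : IsPreconnected s) (hnt : s.Nontrivial) : Cardinal.continuum ≤ Cardinal.mk s := by
  by_contra! hlt
  have := CompletelyRegularSpace.totallySeparatedSpace_of_cardinalMk_lt_continuum hlt
  have := isPreconnected_iff_preconnectedSpace.1 hs
  exact hnt.not_subsingleton (subsingleton_coe s |>.1 subsingleton_of_preconnected_totallyDisconnected)

/-- Dichotomy for flows on a Peano continuum with no Lyapunov unstable compact minimal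
set: every point is recurrent, the flow is non-wandering, and either the flow is
minimal, or `M` is partitioned into continuum-many hyper-stable compact minimal sets
whose collection, with the Hausdorff metric, is a compact, connected, locally connected
metric space, every nonempty open subset of `M` meeting continuum-many of them. -/
theorem no_unstable_minimals_dichotomy
    {M' : Type*} [MetricSpace M'] [CompactSpace M'] [ConnectedSpace M']
    [LocallyConnectedSpace M']
    (φ : ℝ → M' → M')
    (hφcont : Continuous fun p : ℝ × M' => φ p.1 p.2)
    (hφzero : ∀ x : M', φ 0 x = x)
    (hφadd : ∀ s t : ℝ, ∀ x : M', φ s (φ t x) = φ (s + t) x)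
    (hstab : ∀ K : Set M', IsCompactMinimalSet φ K → IsLyapunovStable φ K) :
    (∀ x : M', x ∈ omegaLimitSet φ x) ∧ IsNonWanderingFlow φ ∧
      ((∀ x : M', Dense (Set.range fun t : ℝ => φ t x)) ∨
        ((∀ x : M', ∃ Γ : Set M', IsCompactMinimalSet φ Γ ∧ x ∈ Γ) ∧
          (∀ Γ : Set M', IsCompactMinimalSet φ Γ → IsHyperStable φ Γ) ∧
          IsCompact (CMinSet φ) ∧ IsConnected (CMinSet φ) ∧
          LocallyConnectedSpace ↥(CMinSet φ) ∧
          Cardinal.mk ↥(CMinSet φ) = Cardinal.continuum ∧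
          ∀ A : Set M', IsOpen A → A.Nonempty →
            Cardinal.mk ↥{Γ : NonemptyCompacts M' | IsCompactMinimalSet φ (Γ : Set M') ∧
              ((Γ : Set M') ∩ A).Nonempty} = Cardinal.continuum)) := by
  have h : IsContinuousFlow φ := ⟨hφcont, hφzero, hφadd⟩
  have hmin := h.isCompactMinimalSet_orbitClosure hstab
  have hcont := h.continuous_orbitHull hstab
  have hrec : ∀ x, x ∈ omegaLimitSet φ x := fun x => by
    rw [h.omegaLimitSet_eq_orbitClosure (hmin x)]
    exact h.mem_orbitClosure x
  refine ⟨hrec, fun x U hU T hT => ?_, ?_⟩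
  · obtain ⟨_, hyU, t, ht, rfl⟩ := mem_closure_iff_nhds.1 (mem_iInter₂.1 (hrec x) T hT.le) U hU
    exact ⟨t, ht, φ t x, ⟨x, mem_of_mem_nhds hU, rfl⟩, hyU⟩
  by_cases hall : IsCompactMinimalSet φ univ
  · exact Or.inl fun x => dense_iff_closure_eq.2 (h.orbitClosure_eq hall (mem_univ x))
  have hcard : ∀ A : Set M', IsOpen A → A.Nonempty →
      Cardinal.mk ↥(h.orbitHull '' A) = Cardinal.continuum := by
    rintro A hA ⟨a, ha⟩
    refine le_antisymm ?_ ?_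
    · exact Cardinal.mk_image_le.trans <| (Cardinal.mk_set_le A).trans <|
        Cardinal.mk_le_continuum_of_secondCountable M'
    · have hnt : (h.orbitHull '' connectedComponentIn A a).Nontrivial := by
        by_contra hsub
        rw [not_nontrivial_iff] at hsub
        refine hall ?_
        rw [← h.eq_univ_of_isCompactMinimalSet (hmin a) hA.connectedComponentIn
          ⟨a, mem_connectedComponentIn ha⟩ fun y hy => ?_]
        · exact hmin a
        · rw [← h.coe_orbitHull, hsub (mem_image_of_mem _ (mem_connectedComponentIn ha))
            (mem_image_of_mem _ hy)]
          exact h.mem_orbitClosure y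
      exact ((isPreconnected_connectedComponentIn.image _ hcont.continuousOn).continuum_le_mk
        hnt).trans (Cardinal.mk_le_mk_of_subset (image_mono (connectedComponentIn_subset A a)))
  refine Or.inr ⟨fun x => ⟨_, hmin x, h.mem_orbitClosure x⟩,
    fun Γ hΓ => ⟨hΓ, univ, univ_mem, fun K hK hunst => absurd (hstab K hK) hunst⟩, ?_, ?_, ?_, ?_,
    fun A hA hne => ?_⟩
  · rw [← h.range_orbitHull hstab]
    exact isCompact_range hcont
  · rw [← h.range_orbitHull hstab]
    exact isConnected_range hcont
  · rw [← h.range_orbitHull hstab]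
    exact (hcont.rangeFactorization.isClosedMap.isQuotientMap hcont.rangeFactorization
      rangeFactorization_surjective).isCoinducing.locallyConnectedSpace
  · rw [← h.range_orbitHull hstab, ← image_univ]
    exact hcard univ isOpen_univ univ_nonempty
  · rw [← h.image_orbitHull hstab]
    exact hcard A hA hne
end
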